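/- Let Y be a separable metric space and γ : [0,1] → Y an absolutely continuous curve. Then for Lebesgue-almost every t ∈ (0,1): the metric speed |γ̇_t| = lim_{h→0} d(γ(t+h), γ(t))/|h| exists, and if |γ̇_t| > 0 then lim_{δ→0⁺} ∠̄_{γ(t)}(γ(t+δ), γ(t−δ)) = π, where ∠̄ denotes the Euclidean comparison angle. -/

import Mathlib

open Filter MeasureTheory

/-- The Euclidean comparison angle at `x` between `y` and `z` in a metric space. -/
noncomputable def compAngle {Y : Type*} [MetricSpace Y] (x y z : Y) : ℝ :=
  Real.arccos ((dist x y ^ 2 + dist x z ^ 2 - dist y z ^ 2) / (2 * dist x y * dist x z))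

/-- A differentiable real function has symmetric and one-sided difference quotients converging to
the expected multiple of the absolute value of the derivative. -/
theorem HasDerivAt.tendsto_dist_div_abs {u : ℝ → ℝ} {u' t : ℝ} (hu : HasDerivAt u u' t)
    (α β : ℝ) :
    Tendsto (fun h : ℝ => dist (u (t + α * h)) (u (t + β * h)) / |h|)
      (nhdsWithin 0 {0}ᶜ) (nhds (|α - β| * |u'|)) := by
  have key : ∀ c : ℝ, HasDerivAt (fun h : ℝ => u (t + c * h)) (u' * c) 0 := by
    intro c
    have h1 : HasDerivAt (fun h : ℝ => t + c * h) c 0 := by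
      simpa using ((hasDerivAt_id (0 : ℝ)).const_mul c).const_add t
    have h2 : HasDerivAt u u' (t + c * 0) := by simpa using hu
    exact h2.comp 0 h1
  have h := (hasDerivAt_iff_tendsto_slope_zero.1 ((key α).sub (key β))).abs
  have e : |u' * α - u' * β| = |α - β| * |u'| := by
    rw [← abs_mul]
    congr 1
    ring
  rw [e] at h
  refine h.congr fun x => ?_
  simp [Real.dist_eq, abs_mul, abs_inv, div_eq_inv_mul]

/-- A curve whose increments are dominated by those of an absolutely continuous curve is absolutely
continuous. -/
theorem AbsolutelyContinuousOnInterval.of_dist_le {X Z : Type*} [PseudoMetricSpace X]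
    [PseudoMetricSpace Z] {f : ℝ → X} {g : ℝ → Z} {a b : ℝ}
    (hf : AbsolutelyContinuousOnInterval f a b)
    (h : ∀ s ∈ Set.uIcc a b, ∀ t ∈ Set.uIcc a b, dist (g s) (g t) ≤ dist (f s) (f t)) :
    AbsolutelyContinuousOnInterval g a b := by
  rw [absolutelyContinuousOnInterval_iff] at hf ⊢
  intro ε hε
  obtain ⟨δ, hδ, H⟩ := hf ε hε
  refine ⟨δ, hδ, fun E hE hl => lt_of_le_of_lt (Finset.sum_le_sum fun i hi => ?_) (H E hE hl)⟩
  have := hE.1 i hi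
  exact h _ this.1 _ this.2

/-- If each distance is, up to an arbitrarily small error, an increment of some function `φ n`, and
all increments are dominated by those of `G`, whose derivative at `t` is the supremum of the
`|φ n|'`, then the metric difference quotients at `t` converge. -/
theorem tendsto_dist_div_abs_of_iSup {Y ι : Type*} [PseudoMetricSpace Y] [Nonempty ι] {γ : ℝ → Y}
    {φ : ι → ℝ → ℝ} {φ' : ι → ℝ} {G : ℝ → ℝ} {t : ℝ}
    (hφ : ∀ n, HasDerivAt (φ n) (φ' n) t)
    (hφγ : ∀ n u v, dist (φ n u) (φ n v) ≤ dist (γ u) (γ v))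
    (hG : HasDerivAt G (⨆ n, |φ' n|) t)
    (hγG : ∀ᶠ p : ℝ × ℝ in nhds t ×ˢ nhds t, dist (γ p.1) (γ p.2) ≤ dist (G p.1) (G p.2))
    (α β : ℝ) :
    Tendsto (fun h : ℝ => dist (γ (t + α * h)) (γ (t + β * h)) / |h|)
      (nhdsWithin 0 {0}ᶜ) (nhds (|α - β| * ⨆ n, |φ' n|)) := by
  have hnn : 0 ≤ ⨆ n, |φ' n| := Real.iSup_nonneg fun n => abs_nonneg _
  have hlim : ∀ c : ℝ, Tendsto (fun h : ℝ => t + c * h) (nhdsWithin 0 {0}ᶜ) (nhds t) := by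
    intro c
    have : Tendsto (fun h : ℝ => t + c * h) (nhds 0) (nhds (t + c * 0)) :=
      Continuous.tendsto (by fun_prop) 0
    simpa using this.mono_left nhdsWithin_le_nhds
  have hup := hG.tendsto_dist_div_abs α β
  rw [abs_of_nonneg hnn] at hup
  refine tendsto_order.2 ⟨fun c hc => ?_, fun c hc => ?_⟩
  · obtain ⟨n, hn⟩ : ∃ n, c < |α - β| * |φ' n| := by
      rw [Real.mul_iSup_of_nonneg (abs_nonneg _)] at hc
      exact exists_lt_of_lt_ciSup hc
    filter_upwards [((hφ n).tendsto_dist_div_abs α β).eventually_const_lt hn] with h hh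
    exact hh.trans_le (by gcongr; exact hφγ n _ _)
  · filter_upwards [hup.eventually_lt_const hc, ((hlim α).prodMk (hlim β)).eventually hγG]
      with h hh hle
    exact lt_of_le_of_lt (by gcongr) hh

/-- In a metric space with a dense sequence, a uniform bound on the increments of the distance
functions to the sequence bounds the distance. -/
theorem dist_le_of_forall_dist_sub_dist_le {Y ι : Type*} [PseudoMetricSpace Y] {e : ι → Y}
    (he : DenseRange e) {x y : Y} {C : ℝ} (h : ∀ n, dist y (e n) - dist x (e n) ≤ C) :
    dist x y ≤ C := by
  refine le_of_forall_pos_le_add fun ε hε => ?_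
  obtain ⟨n, hn⟩ := he.exists_dist_lt x (half_pos hε)
  have := dist_triangle_right x y (e n)
  linarith [h n]

/-- An absolutely continuous curve in a separable metric space has, at almost every point of the
interval, a metric derivative `m`, which moreover controls all difference quotients along a pair of
points approaching the base point linearly. -/
theorem ae_exists_tendsto_dist_div_abs {Y : Type*} [PseudoMetricSpace Y]
    [TopologicalSpace.SeparableSpace Y] {γ : ℝ → Y} {f : ℝ → ℝ} {a b : ℝ} (hab : a ≤ b)
    (hf : IntegrableOn f (Set.Icc a b))
    (hγ : ∀ s t : ℝ, a ≤ s → s ≤ t → t ≤ b → dist (γ s) (γ t) ≤ ∫ r in s..t, f r) :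
    ∀ᵐ t, t ∈ Set.Ioo a b → ∃ m : ℝ, ∀ α β : ℝ,
      Tendsto (fun h : ℝ => dist (γ (t + α * h)) (γ (t + β * h)) / |h|)
        (nhdsWithin 0 {0}ᶜ) (nhds (|α - β| * m)) := by
  have : Nonempty Y := ⟨γ a⟩
  have hfi : IntervalIntegrable f volume a b :=
    (intervalIntegrable_iff_integrableOn_Icc_of_le hab).2 hf
  have huIcc : Set.uIcc a b = Set.Icc a b := Set.uIcc_of_le hab
  have hsub : ∀ {g : ℝ → ℝ}, IntervalIntegrable g volume a b → ∀ s ∈ Set.Icc a b,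
      ∀ t ∈ Set.Icc a b, IntervalIntegrable g volume s t := by
    intro g hg s hs t ht
    exact hg.mono_set (by rw [huIcc]; exact Set.uIcc_subset_Icc hs ht)
  -- domination of increments by those of a primitive
  have hprim : ∀ {g : ℝ → ℝ}, IntervalIntegrable g volume a b →
      (∀ s t : ℝ, a ≤ s → s ≤ t → t ≤ b → dist (γ s) (γ t) ≤ ∫ r in s..t, g r) →
      ∀ s ∈ Set.Icc a b, ∀ t ∈ Set.Icc a b,
        dist (γ s) (γ t) ≤ dist (∫ r in a..s, g r) (∫ r in a..t, g r) := by
    intro g hg H s hs t ht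
    wlog hst : s ≤ t generalizing s t
    · rw [dist_comm, dist_comm (∫ r in a..s, g r)]
      exact this t ht s hs (le_of_not_ge hst)
    have ha : a ∈ Set.Icc a b := Set.left_mem_Icc.2 hab
    rw [dist_comm (∫ r in a..s, g r), Real.dist_eq, intervalIntegral.integral_interval_sub_left
      (hsub hg a ha t ht) (hsub hg a ha s hs)]
    exact (H s t hs.1 hst ht.2).trans (le_abs_self _)
  let e : ℕ → Y := TopologicalSpace.denseSeq Y
  have he : DenseRange e := TopologicalSpace.denseRange_denseSeq Y
  let φ : ℕ → ℝ → ℝ := fun n s => dist (γ s) (e n)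
  have hφγ : ∀ n u v, dist (φ n u) (φ n v) ≤ dist (γ u) (γ v) := fun n u v =>
    dist_dist_dist_le_left _ _ _
  have hφac : ∀ n, AbsolutelyContinuousOnInterval (φ n) a b := fun n =>
    (hfi.absolutelyContinuousOnInterval_intervalIntegral Set.left_mem_uIcc).of_dist_le
      fun s hs t ht => (hφγ n s t).trans
        (hprim hfi hγ s (huIcc ▸ hs) t (huIcc ▸ ht))
  have hdiff : ∀ᵐ t, ∀ n, t ∈ Set.uIcc a b → DifferentiableAt ℝ (φ n) t :=
    ae_all_iff.2 fun n => (hφac n).ae_differentiableAt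
  have hnear : ∀ {t : ℝ}, t ∈ Set.Ioo a b → ∀ᶠ p : ℝ × ℝ in nhds t ×ˢ nhds t,
      p.1 ∈ Set.Icc a b ∧ p.2 ∈ Set.Icc a b := fun ht =>
    prod_mem_prod (Icc_mem_nhds ht.1 ht.2) (Icc_mem_nhds ht.1 ht.2)
  have hbound : ∀ᵐ t, t ∈ Set.Ioo a b → ∀ n, |deriv (φ n) t| ≤ |f t| := by
    filter_upwards [hdiff, hfi.ae_hasDerivAt_integral] with t ht1 ht2 ht n
    have htI : t ∈ Set.uIcc a b := huIcc ▸ Set.Ioo_subset_Icc_self ht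
    have h1 := (ht1 n htI).hasDerivAt.tendsto_dist_div_abs 1 0
    have h2 := (ht2 htI a Set.left_mem_uIcc).tendsto_dist_div_abs 1 0
    have hlim : Tendsto (fun h : ℝ => t + 1 * h) (nhdsWithin 0 {0}ᶜ) (nhds t) := by
      have : Tendsto (fun h : ℝ => t + 1 * h) (nhds 0) (nhds (t + 1 * 0)) :=
        Continuous.tendsto (by fun_prop) 0
      simpa using this.mono_left nhdsWithin_le_nhds
    have hle := le_of_tendsto_of_tendsto h1 h2 (by
      filter_upwards [hlim.eventually (Icc_mem_nhds ht.1 ht.2)] with h hh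
      gcongr
      exact (hφγ n _ _).trans
        (hprim hfi hγ _ hh _ (by simpa using Set.Ioo_subset_Icc_self ht)))
    simpa using hle
  let g : ℝ → ℝ := fun t => ⨆ n, |deriv (φ n) t|
  have hgm : Measurable g := Measurable.iSup fun n => (measurable_deriv (φ n)).abs
  have hIoo : ∀ᵐ t ∂(volume.restrict (Set.Icc a b)), ∀ n, |deriv (φ n) t| ≤ |f t| := by
    rw [← restrict_Ioo_eq_restrict_Icc]
    exact (ae_restrict_iff' measurableSet_Ioo).2 hbound
  have hgi : IntervalIntegrable g volume a b := by
    refine (intervalIntegrable_iff_integrableOn_Icc_of_le hab).2 ?_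
    refine Integrable.mono hf hgm.aestronglyMeasurable ?_
    filter_upwards [hIoo] with t ht
    rw [Real.norm_eq_abs, abs_of_nonneg (Real.iSup_nonneg fun n => abs_nonneg _)]
    exact ciSup_le ht
  have hγg : ∀ s t : ℝ, a ≤ s → s ≤ t → t ≤ b → dist (γ s) (γ t) ≤ ∫ r in s..t, g r := by
    intro s t hs hst ht
    have hsI : s ∈ Set.Icc a b := ⟨hs, hst.trans ht⟩
    have htI : t ∈ Set.Icc a b := ⟨hs.trans hst, ht⟩
    refine dist_le_of_forall_dist_sub_dist_le he fun n => ?_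
    have hac : AbsolutelyContinuousOnInterval (φ n) s t :=
      (hφac n).mono (by rw [huIcc]; exact Set.uIcc_subset_Icc hsI htI)
    change φ n t - φ n s ≤ _
    rw [← hac.integral_deriv_eq_sub]
    refine intervalIntegral.integral_mono_ae_restrict hst hac.intervalIntegrable_deriv
      (hsub hgi s hsI t htI) ?_
    filter_upwards [ae_restrict_of_ae_restrict_of_subset (Set.Icc_subset_Icc hs ht) hIoo]
      with r hr
    exact (le_abs_self _).trans
      (le_ciSup (f := fun n => |deriv (φ n) r|) ⟨_, Set.forall_mem_range.2 hr⟩ n)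
  filter_upwards [hdiff, hgi.ae_hasDerivAt_integral] with t ht1 ht2 ht
  have htI : t ∈ Set.uIcc a b := huIcc ▸ Set.Ioo_subset_Icc_self ht
  refine ⟨g t, tendsto_dist_div_abs_of_iSup (fun n => (ht1 n htI).hasDerivAt) hφγ
    (ht2 htI a Set.left_mem_uIcc) ?_⟩
  filter_upwards [hnear ht] with p hp
  exact hprim hgi hγg _ hp.1 _ hp.2

/-- The comparison angle depends only on the mutual distances up to scaling. -/
theorem compAngle_eq_arccos_div {Y : Type*} [MetricSpace Y] (x y z : Y) {r : ℝ} (hr : r ≠ 0) :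
    compAngle x y z = Real.arccos (((dist x y / r) ^ 2 + (dist x z / r) ^ 2 - (dist y z / r) ^ 2) /
      (2 * (dist x y / r) * (dist x z / r))) := by
  have h1 : (dist x y / r) ^ 2 + (dist x z / r) ^ 2 - (dist y z / r) ^ 2 =
      (dist x y ^ 2 + dist x z ^ 2 - dist y z ^ 2) / r ^ 2 := by ring
  have h2 : 2 * (dist x y / r) * (dist x z / r) = 2 * dist x y * dist x z / r ^ 2 := by ring
  rw [compAngle, h1, h2, div_div_div_cancel_right₀ (pow_ne_zero 2 hr)]

/-- If `γ : [0,1] → Y` is an absolutely continuous curve in a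
separable metric space, then for a.e. `t ∈ (0,1)` the metric speed exists and, if it
is positive, the comparison angle at `γ t` between `γ (t+δ)` and `γ (t−δ)` tends to
`π` as `δ → 0⁺`. -/
theorem ae_comparison_angle_antipodal
    {Y : Type*} [MetricSpace Y] [TopologicalSpace.SeparableSpace Y]
    (γ : ℝ → Y)
    (hAC : ∃ f : ℝ → ℝ, IntegrableOn f (Set.Icc (0:ℝ) 1) ∧
      ∀ s t : ℝ, 0 ≤ s → s ≤ t → t ≤ 1 → dist (γ s) (γ t) ≤ ∫ r in s..t, f r) :
    ∀ᵐ t ∂(volume.restrict (Set.Ioo (0:ℝ) 1)),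
      ∃ ms : ℝ,
        Tendsto (fun h : ℝ => dist (γ (t + h)) (γ t) / |h|)
          (nhdsWithin 0 {0}ᶜ) (nhds ms) ∧
        (0 < ms →
          Tendsto (fun δ : ℝ => compAngle (γ t) (γ (t + δ)) (γ (t - δ)))
            (nhdsWithin 0 (Set.Ioi 0)) (nhds Real.pi)) := by
 
  obtain ⟨f, hf, hγ⟩ := hAC
  rw [ae_restrict_iff' measurableSet_Ioo]
  filter_upwards [ae_exists_tendsto_dist_div_abs zero_le_one hf hγ] with t ht htI
  obtain ⟨m, hm⟩ := ht htI
  refine ⟨m, by simpa using hm 1 0, fun hpos => ?_⟩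
  have hr : nhdsWithin (0 : ℝ) (Set.Ioi 0) ≤ nhdsWithin 0 {0}ᶜ :=
    nhdsWithin_mono _ fun x hx => ne_of_gt hx
  have h1 := (hm 0 1).mono_left hr
  have h2 := (hm 0 (-1)).mono_left hr
  have h3 := (hm 1 (-1)).mono_left hr
  have hlim := (Real.continuous_arccos.tendsto _).comp
    ((((h1.pow 2).add (h2.pow 2)).sub (h3.pow 2)).div ((h1.const_mul 2).mul h2)
      (by norm_num; exact hpos.ne'))
  have hval : ((|(0 : ℝ) - 1| * m) ^ 2 + (|(0 : ℝ) - -1| * m) ^ 2 - (|(1 : ℝ) - -1| * m) ^ 2) /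
      (2 * (|(0 : ℝ) - 1| * m) * (|(0 : ℝ) - -1| * m)) = -1 := by
    norm_num
    field_simp
    norm_num
  rw [hval, Real.arccos_neg_one] at hlim
  refine hlim.congr' ?_
  filter_upwards [self_mem_nhdsWithin] with δ hδ
  rw [compAngle_eq_arccos_div _ _ _ (abs_pos.2 (ne_of_gt hδ)).ne']
  simp [sub_eq_add_neg]
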